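/- In an add-only attribute system satisfying SR_d with initial state S and goal G, if the required set D of G is not contained in G (equivalently, some positive precondition forced by the backward closure lies outside G), then no plan reaches exactly the state G; i.e., RP₌(G) is false. -/

import Mathlib

/-- A rule of an add-only attribute system: a target item, a positive
precondition set and a negative precondition set. -/
structure Rule (α : Type*) where
  tgt : α
  pos : Finset α
  neg : Finset α

variable {α : Type*} [DecidableEq α]

/-- A rule is applicable in a state `T` if its positive preconditions are
contained in `T` and its negative preconditions are disjoint from `T`. -/
def Applicable (r : Rule α) (T : Finset α) : Prop :=
  r.pos ⊆ T ∧ r.neg ∩ T = ∅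

/-- Applying a rule adds its target to the state. -/
def applyRule (r : Rule α) (T : Finset α) : Finset α :=
  insert r.tgt T

/-- The state obtained from `S` after applying the rules of `plan` in order. -/
def runPlan (S : Finset α) (plan : List (Rule α)) : Finset α :=
  plan.foldl (fun T r => applyRule r T) S

/-- A valid plan from a state: each rule belongs to the rule set `R` and is
applicable in the state obtained by applying the previous rules. -/
def IsPlan (R : Set (Rule α)) : Finset α → List (Rule α) → Prop
  | _, [] => True
  | T, r :: rs => r ∈ R ∧ Applicable r T ∧ IsPlan R (applyRule r T) rs

/-- `SR_d` restriction: at most one rule per target. -/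
def SRd (R : Set (Rule α)) : Prop :=
  ∀ r ∈ R, ∀ r' ∈ R, r.tgt = r'.tgt → r = r'

/-- The required set of a goal `G`: the least set containing `G \ S` and
closed under taking positive preconditions (outside `S`) of rules whose
target is required. -/
inductive Required (R : Set (Rule α)) (S G : Finset α) : α → Prop
  | base (a : α) : a ∈ G → a ∉ S → Required R S G a
  | step (r : Rule α) (b : α) : r ∈ R → Required R S G r.tgt →
      b ∈ r.pos → b ∉ S → Required R S G b

/-- Edge of the precedence digraph: `a` must be added strictly before `b`. -/
def Edge (R : Set (Rule α)) (a b : α) : Prop :=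
  a ≠ b ∧ ∃ ra ∈ R, ra.tgt = a ∧ ∃ rb ∈ R, rb.tgt = b ∧
    (a ∈ rb.pos ∨ b ∈ ra.neg)

/-- The precedence digraph restricted to a vertex set `V` contains a
directed cycle. -/
def HasCycleOn (R : Set (Rule α)) (V : Set α) : Prop :=
  ∃ (a : α) (l : List α), (∀ x ∈ a :: l, x ∈ V) ∧ List.Chain (Edge R) a (l ++ [a])

theorem subset_runPlan (T : Finset α) (plan : List (Rule α)) : T ⊆ runPlan T plan := by
  induction plan generalizing T with
  | nil => exact Finset.Subset.refl T
  | cons r rs ih => exact (Finset.subset_insert r.tgt T).trans (ih (applyRule r T))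

/-- Every item added by a plan is the target of a rule whose positive preconditions
hold in the final state. -/
theorem IsPlan.exists_rule_of_mem_runPlan {R : Set (Rule α)} {T : Finset α}
    {plan : List (Rule α)} (hplan : IsPlan R T plan) {a : α}
    (ha : a ∈ runPlan T plan) (haT : a ∉ T) :
    ∃ r ∈ R, r.tgt = a ∧ r.pos ⊆ runPlan T plan := by
  induction plan generalizing T with
  | nil => exact absurd ha haT
  | cons r rs ih =>
    obtain ⟨hr, happ, hrs⟩ := hplan
    by_cases hra : r.tgt = a
    · exact ⟨r, hr, hra, happ.1.trans (subset_runPlan T (r :: rs))⟩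
    · refine ih hrs ha fun hmem => ?_
      rcases Finset.mem_insert.mp hmem with rfl | hmem
      · exact hra rfl
      · exact haT hmem

/-- Under `SR_d`, the required set of a state reached by a plan is contained in the items
the plan adds. -/
theorem Required.mem_runPlan {R : Set (Rule α)} (hSR : SRd R) {S : Finset α}
    {plan : List (Rule α)} (hplan : IsPlan R S plan) {a : α}
    (ha : Required R S (runPlan S plan) a) : a ∈ runPlan S plan ∧ a ∉ S := by
  induction ha with
  | base a haG haS => exact ⟨haG, haS⟩
  | step r b hr _ hb hbS ih =>
    obtain ⟨r', hr', htgt, hpos⟩ := hplan.exists_rule_of_mem_runPlan ih.1 ih.2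
    obtain rfl := hSR r' hr' r hr htgt
    exact ⟨hpos hb, hbS⟩

/-- Under `SR_d`, if the required set `D` of `G` is not
contained in `G`, then no plan reaches exactly `G`: `RP₌(G)` is false. -/
theorem stmt10 (R : Set (Rule α)) (hSR : SRd R) (S G : Finset α)
    (h : ∃ a : α, Required R S G a ∧ a ∉ G) :
    ¬ ∃ plan : List (Rule α), IsPlan R S plan ∧ runPlan S plan = G := by
  rintro ⟨plan, hplan, rfl⟩
  obtain ⟨a, ha, haG⟩ := h
  exact haG (ha.mem_runPlan hSR hplan).1
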